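/- Let q ≥ 2 be an integer, β > 0, C₀ > 0, and let p, p' be conjugate exponents with 1 ≤ p' < 2 < p ≤ ∞ (1/p + 1/p' = 1). There exist constants β_p > 0 and C > 0, depending only on q, β, C₀, p, such that the following holds. Let G be any finite (q+1)-regular Ramanujan graph with vertex set V and let N be an integer with 1 ≤ N ≤ log_q |V| such that Condition (★★) holds with constants β, C₀ and the integer N. Then for every integer 1 ≤ n ≤ N and every function f : V → ℝ, ‖S_n Π f‖_p ≤ C · q^{−β_p · n} · ‖f‖_{p'}. -/

import Mathlib

open Finset ENNReal

/-- The normalized adjacency operator `T_q f (x) = q^{-1/2} ∑_{y ~ x} f(y)`. -/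
noncomputable def Tq {V : Type*} [Fintype V] (q : ℕ) (G : SimpleGraph V)
    [DecidableRel G.Adj] (f : V → ℝ) : V → ℝ :=
  fun x => (Real.sqrt q)⁻¹ * ∑ y ∈ G.neighborFinset x, f y

/-- The sphere-averaging operators: `S_0 = Id`, `S_1 = T_q`,
`S_2 = T_q ∘ S_1 - (1 + 1/q)·Id`, `S_{n+1} = T_q ∘ S_n - S_{n-1}` for `n ≥ 2`. -/
noncomputable def Sop {V : Type*} [Fintype V] (q : ℕ) (G : SimpleGraph V)
    [DecidableRel G.Adj] : ℕ → (V → ℝ) → (V → ℝ)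
  | 0 => fun f => f
  | 1 => fun f => Tq q G f
  | 2 => fun f x => Tq q G (Tq q G f) x - (1 + 1 / (q : ℝ)) * f x
  | (n + 3) => fun f x => Tq q G (Sop q G (n + 2) f) x - Sop q G (n + 1) f x

/-- The kernel `K_n(x,y) = (S_n δ_y)(x)`. -/
noncomputable def Kker {V : Type*} [Fintype V] [DecidableEq V] (q : ℕ) (G : SimpleGraph V)
    [DecidableRel G.Adj] (n : ℕ) (x y : V) : ℝ :=
  Sop q G n (fun z => if z = y then 1 else 0) x

/-- Condition (★★): `max_{x,y} |K_n(x,y)| ≤ C₀ · q^{-βn}` for all `1 ≤ n ≤ N`. -/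
def CondStarStar {V : Type*} [Fintype V] [DecidableEq V] (q : ℕ) (G : SimpleGraph V)
    [DecidableRel G.Adj] (β C₀ : ℝ) (N : ℕ) : Prop :=
  ∀ n : ℕ, 1 ≤ n → n ≤ N → ∀ x y : V,
    |Kker q G n x y| ≤ C₀ * (q : ℝ) ^ (-(β * (n : ℝ)))

/-- `G` is Ramanujan: the spectrum of `T_q` is contained in `[-2,2] ∪ {(q+1)/√q}`, and the
eigenspace of the eigenvalue `(q+1)/√q` consists exactly of the constant functions. -/
def IsRamanujan {V : Type*} [Fintype V] (q : ℕ) (G : SimpleGraph V)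
    [DecidableRel G.Adj] : Prop :=
  (∀ (f : V → ℝ) (lam : ℝ), f ≠ 0 → (Tq q G f = fun x => lam * f x) →
      lam ∈ Set.Icc (-2 : ℝ) 2 ∨ lam = ((q : ℝ) + 1) / Real.sqrt q) ∧
  (∀ f : V → ℝ, (Tq q G f = fun x => ((q : ℝ) + 1) / Real.sqrt q * f x) →
      ∃ a : ℝ, f = fun _ => a)

/-- The `ℓ^p` norm with respect to counting measure: `(∑_x |f(x)|^p)^{1/p}`. -/
noncomputable def lpN {V : Type*} [Fintype V] (p : ℝ) (f : V → ℝ) : ℝ :=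
  (∑ x, |f x| ^ p) ^ (1 / p)


/-- The projection onto the orthogonal complement of the constants:
`Πf = f - (1/|V|) ∑_y f(y)`. -/
noncomputable def Pproj {V : Type*} [Fintype V] (f : V → ℝ) : V → ℝ :=
  fun x => f x - (∑ y, f y) / (Fintype.card V)

/-- The `ℓ^p` norm for an extended-real exponent `p` (counting measure on `V`):
for finite `p` it is `(∑_x |f(x)|^p)^{1/p}`, and for `p = ∞` it is `max_x |f(x)|`. -/
noncomputable def gNorm {V : Type*} [Fintype V] (p : ℝ≥0∞) (f : V → ℝ) : ℝ :=
  if p = ⊤ then ⨆ x, |f x| else (∑ x, |f x| ^ p.toReal) ^ (1 / p.toReal)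

/-- The analytic family `z ↦ sign t · |t| ^ (r (1 - z / 2))`. -/
noncomputable def signedCpow (r t : ℝ) (z : ℂ) : ℂ :=
  ((SignType.sign t : ℝ) : ℂ) * Complex.exp ((r * Real.log |t| : ℝ) * (1 - z / 2))

theorem differentiable_signedCpow (r t : ℝ) : Differentiable ℂ (signedCpow r t) := by
  unfold signedCpow
  fun_prop

theorem norm_signedCpow {r : ℝ} (hr : 0 < r) (t : ℝ) {z : ℂ} (hz : z.re < 2) :
    ‖signedCpow r t z‖ = |t| ^ (r * (1 - z.re / 2)) := by
  unfold signedCpow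
  rcases eq_or_ne t 0 with rfl | ht
  · have : r * (1 - z.re / 2) ≠ 0 := by
      have : 0 < 1 - z.re / 2 := by linarith
      positivity
    simp [Real.zero_rpow this]
  · have hs : ‖((SignType.sign t : ℝ) : ℂ)‖ = 1 := by
      rcases lt_or_gt_of_ne ht with h | h <;> simp [h]
    rw [norm_mul, hs, one_mul, Complex.norm_exp, Complex.re_ofReal_mul,
      Real.rpow_def_of_pos (abs_pos.2 ht)]
    congr 1
    have : (z / 2).re = z.re / 2 := by
      rw [show (2 : ℂ) = ((2 : ℝ) : ℂ) by norm_num, Complex.div_ofReal_re]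
    rw [Complex.sub_re, Complex.one_re, this]
    ring

theorem signedCpow_ofReal {r θ : ℝ} (h : r * (1 - θ / 2) = 1) (t : ℝ) :
    signedCpow r t (θ : ℂ) = t := by
  unfold signedCpow
  rcases eq_or_ne t 0 with rfl | ht
  · simp
  · have : (((r * Real.log |t| : ℝ) : ℂ) * (1 - (θ : ℂ) / 2)) = ((Real.log |t| : ℝ) : ℂ) := by
      have h' : (r : ℂ) * (1 - (θ : ℂ) / 2) = 1 := by exact_mod_cast h
      push_cast
      linear_combination (Real.log |t| : ℂ) * h'
    rw [this, ← Complex.ofReal_exp, Real.exp_log (abs_pos.2 ht), ← Complex.ofReal_mul,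
      sign_mul_abs]

theorem norm_sum_kernel_complex_le {V W : Type*} [Fintype V] [Fintype W] {K : V → W → ℝ} {b : ℝ}
    (hb : 0 ≤ b)
    (hK : ∀ (f : W → ℝ) (g : V → ℝ),
      |∑ x, ∑ y, K x y * f y * g x| ≤ b * (√(∑ y, f y ^ 2) * √(∑ x, g x ^ 2)))
    (u : W → ℂ) (w : V → ℂ) :
    ‖∑ x, ∑ y, (K x y : ℂ) * u y * w x‖ ≤
      4 * b * (√(∑ y, ‖u y‖ ^ 2) * √(∑ x, ‖w x‖ ^ 2)) := by
  have key : ∀ (f : W → ℝ) (g : V → ℝ), (∀ y, |f y| ≤ ‖u y‖) → (∀ x, |g x| ≤ ‖w x‖) →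
      |∑ x, ∑ y, K x y * f y * g x| ≤ b * (√(∑ y, ‖u y‖ ^ 2) * √(∑ x, ‖w x‖ ^ 2)) := by
    intro f g hf hg
    refine (hK f g).trans ?_
    have hfs : ∑ y, f y ^ 2 ≤ ∑ y, ‖u y‖ ^ 2 := Finset.sum_le_sum fun y _ =>
      sq_le_sq.2 (by rw [abs_norm]; exact hf y)
    have hgs : ∑ x, g x ^ 2 ≤ ∑ x, ‖w x‖ ^ 2 := Finset.sum_le_sum fun x _ =>
      sq_le_sq.2 (by rw [abs_norm]; exact hg x)
    gcongr
  have hre : ∀ z : ℂ, |z.re| ≤ ‖z‖ := Complex.abs_re_le_norm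
  have him : ∀ z : ℂ, |z.im| ≤ ‖z‖ := Complex.abs_im_le_norm
  have h1 := key (fun y => (u y).re) (fun x => (w x).re) (fun _ => hre _) (fun _ => hre _)
  have h2 := key (fun y => (u y).im) (fun x => (w x).im) (fun _ => him _) (fun _ => him _)
  have h3 := key (fun y => (u y).re) (fun x => (w x).im) (fun _ => hre _) (fun _ => him _)
  have h4 := key (fun y => (u y).im) (fun x => (w x).re) (fun _ => him _) (fun _ => hre _)
  refine (Complex.norm_le_abs_re_add_abs_im _).trans ?_
  have e1 : (∑ x, ∑ y, (K x y : ℂ) * u y * w x).re =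
      ∑ x, ∑ y, K x y * (u y).re * (w x).re - ∑ x, ∑ y, K x y * (u y).im * (w x).im := by
    simp [Complex.re_sum, Complex.mul_re, ← Finset.sum_sub_distrib]
  have e2 : (∑ x, ∑ y, (K x y : ℂ) * u y * w x).im =
      ∑ x, ∑ y, K x y * (u y).re * (w x).im + ∑ x, ∑ y, K x y * (u y).im * (w x).re := by
    simp [Complex.im_sum, Complex.mul_im, ← Finset.sum_add_distrib]
  rw [e1, e2]
  have := abs_sub (∑ x, ∑ y, K x y * (u y).re * (w x).re) (∑ x, ∑ y, K x y * (u y).im * (w x).im)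
  have := abs_add_le (∑ x, ∑ y, K x y * (u y).re * (w x).im)
    (∑ x, ∑ y, K x y * (u y).im * (w x).re)
  linarith

theorem abs_sum_kernel_interpolate {V W : Type*} [Fintype V] [Fintype W] {K : V → W → ℝ}
    {a b : ℝ} (ha : 0 ≤ a) (hb : 0 ≤ b) (hKa : ∀ x y, |K x y| ≤ a)
    (hKb : ∀ (f : W → ℝ) (g : V → ℝ),
      |∑ x, ∑ y, K x y * f y * g x| ≤ b * (√(∑ y, f y ^ 2) * √(∑ x, g x ^ 2)))
    {r θ : ℝ} (hr : 0 < r) (hθ0 : 0 ≤ θ) (hθ1 : θ ≤ 1) (hrθ : r * (1 - θ / 2) = 1)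
    (f : W → ℝ) (g : V → ℝ) :
    |∑ x, ∑ y, K x y * f y * g x| ≤
      a ^ (1 - θ) * (4 * b) ^ θ * ((∑ y, |f y| ^ r) ^ (1 / r) * (∑ x, |g x| ^ r) ^ (1 / r)) := by
  set A := ∑ y, |f y| ^ r with hA
  set D := ∑ x, |g x| ^ r with hD
  have hA0 : 0 ≤ A := by positivity
  have hD0 : 0 ≤ D := by positivity
  let F : ℂ → ℂ := fun z => ∑ x, ∑ y, (K x y : ℂ) * signedCpow r (f y) z * signedCpow r (g x) z
  have hFd : Differentiable ℂ F := by
    have := differentiable_signedCpow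
    fun_prop
  have hF0 : ∀ z ∈ Complex.re ⁻¹' {(0 : ℝ)}, ‖F z‖ ≤ a * (A * D) := by
    intro z hz
    have hz : z.re = 0 := hz
    have hn : ∀ t, ‖signedCpow r t z‖ = |t| ^ r := fun t => by
      rw [norm_signedCpow hr t (by rw [hz]; norm_num), hz]
      simp
    calc ‖F z‖ ≤ ∑ x, ∑ y, a * (|f y| ^ r * |g x| ^ r) := by
          refine norm_sum_le_of_le _ fun x _ => norm_sum_le_of_le _ fun y _ => ?_
          rw [norm_mul, norm_mul, hn, hn, mul_assoc, Complex.norm_real, Real.norm_eq_abs]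
          gcongr
          exact hKa x y
      _ = a * (A * D) := by
          rw [hA, hD, Finset.sum_mul_sum, Finset.sum_comm]
          simp only [Finset.mul_sum]
  have hF1 : ∀ z ∈ Complex.re ⁻¹' {(1 : ℝ)}, ‖F z‖ ≤ 4 * b * (√A * √D) := by
    intro z hz
    have hz : z.re = 1 := hz
    have hn : ∀ t, ‖signedCpow r t z‖ ^ 2 = |t| ^ r := fun t => by
      rw [norm_signedCpow hr t (by rw [hz]; norm_num), hz, ← Real.rpow_natCast,
        ← Real.rpow_mul (abs_nonneg _)]
      congr 1
      push_cast
      ring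
    have := norm_sum_kernel_complex_le hb hKb (fun y => signedCpow r (f y) z)
      (fun x => signedCpow r (g x) z)
    simpa only [hn] using this
  have hB : BddAbove ((norm ∘ F) '' Complex.HadamardThreeLines.verticalClosedStrip 0 1) := by
    refine ⟨∑ x, ∑ y, |K x y| * (1 + |f y|) ^ r * (1 + |g x|) ^ r, ?_⟩
    rintro _ ⟨z, ⟨hz0, hz1⟩, rfl⟩
    have hn : ∀ t, ‖signedCpow r t z‖ ≤ (1 + |t|) ^ r := fun t => by
      rw [norm_signedCpow hr t (by linarith)]
      have h0 : 0 ≤ 1 - z.re / 2 := by linarith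
      calc |t| ^ (r * (1 - z.re / 2)) ≤ (1 + |t|) ^ (r * (1 - z.re / 2)) := by
            gcongr
            linarith
        _ ≤ (1 + |t|) ^ r := by
            refine Real.rpow_le_rpow_of_exponent_le (by linarith [abs_nonneg t]) ?_
            nlinarith
    refine norm_sum_le_of_le _ fun x _ => norm_sum_le_of_le _ fun y _ => ?_
    rw [norm_mul, norm_mul, Complex.norm_real, Real.norm_eq_abs]
    gcongr
    · exact hn _
    · exact hn _
  have h3 := Complex.HadamardThreeLines.norm_le_interp_of_mem_verticalClosedStrip'
    (z := (θ : ℂ)) zero_lt_one ⟨by simpa using hθ0, by simpa using hθ1⟩ hFd.diffContOnCl hB hF0 hF1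
  have hFθ : F θ = ((∑ x, ∑ y, K x y * f y * g x : ℝ) : ℂ) := by
    simp [F, signedCpow_ofReal hrθ]
  rw [hFθ, Complex.norm_real, Real.norm_eq_abs] at h3
  refine h3.trans_eq ?_
  have h1r : 1 / r = (1 - θ) + θ / 2 := by
    rw [div_eq_iff hr.ne']
    linarith
  have hpow : ∀ x : ℝ, 0 ≤ x → x ^ (1 / r) = x ^ (1 - θ) * √x ^ θ := fun x hx => by
    rw [h1r, Real.rpow_add_of_nonneg hx (by linarith) (by linarith), Real.sqrt_eq_rpow,
      ← Real.rpow_mul hx]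
    congr 2
    ring
  simp only [Complex.ofReal_re, sub_zero, div_one]
  rw [Real.mul_rpow ha (by positivity), Real.mul_rpow hA0 hD0, Real.mul_rpow (by positivity)
    (by positivity), Real.mul_rpow (x := √A) (by positivity) (by positivity), hpow A hA0, hpow D hD0]
  ring

theorem gNorm_kernel_le {V W : Type*} [Fintype V] [Fintype W] {K : V → W → ℝ}
    {a b : ℝ} (ha : 0 ≤ a) (hb : 0 ≤ b) (hKa : ∀ x y, |K x y| ≤ a)
    (hKb : ∀ (f : W → ℝ) (g : V → ℝ),
      |∑ x, ∑ y, K x y * f y * g x| ≤ b * (√(∑ y, f y ^ 2) * √(∑ x, g x ^ 2)))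
    {p p' : ℝ≥0∞} (hp2 : 2 < p) (hconj : 1 / p + 1 / p' = 1) (f : W → ℝ) :
    gNorm p (fun x => ∑ y, K x y * f y) ≤
      a ^ (1 - 2 / p.toReal) * (4 * b) ^ (2 / p.toReal) * gNorm p' f := by
  rcases eq_or_ne p ⊤ with rfl | hp
  · have hp' : p' = 1 := by simpa using hconj
    subst hp'
    have hnn : 0 ≤ a * ∑ y, |f y| := by positivity
    simp only [gNorm, if_true, toReal_top, _root_.div_zero, _root_.sub_zero, Real.rpow_one, Real.rpow_zero,
      mul_one, one_ne_top, if_false, toReal_one, div_one]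
    refine Real.iSup_le (fun x => ?_) hnn
    rw [Finset.mul_sum]
    refine Finset.abs_sum_le_sum_abs _ _ |>.trans (Finset.sum_le_sum fun y _ => ?_)
    rw [abs_mul]
    gcongr
    exact hKa x y
  · have hp'0 : p' ≠ 0 := by
      rintro rfl
      simp at hconj
    have hp0 : p ≠ 0 := (zero_lt_two.trans hp2).ne'
    have hp't : p' ≠ ⊤ := by
      rintro rfl
      rw [div_top, add_zero, one_div, ENNReal.inv_eq_one] at hconj
      rw [hconj] at hp2
      exact absurd hp2 (by norm_num)
    set s := p.toReal with hs
    set r := p'.toReal with hr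
    have hs2 : 2 < s := by
      have := (ENNReal.toReal_lt_toReal (by norm_num) hp).2 hp2
      simpa using this
    have hr0 : 0 < r := ENNReal.toReal_pos hp'0 hp't
    have hsr : 1 / s + 1 / r = 1 := by
      have := congrArg ENNReal.toReal hconj
      rw [ENNReal.toReal_add (by simp [hp0]) (by simp [hp'0])] at this
      simpa using this
    have hs0 : 0 < s := by linarith
    simp only [gNorm, hp, hp't, if_false]
    set h : V → ℝ := fun x => ∑ y, K x y * f y with hh
    set M := a ^ (1 - 2 / s) * (4 * b) ^ (2 / s)
    set H := ∑ x, |h x| ^ s with hH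
    have hH0 : 0 ≤ H := by positivity
    have hM0 : 0 ≤ M := by positivity
    let g : V → ℝ := fun x => SignType.sign (h x) * |h x| ^ (s - 1)
    have h1r : 1 / r = 1 - 1 / s := by linarith
    have hrs : (s - 1) * r = s := by
      field_simp at hsr
      linarith
    have hfg : ∑ x, ∑ y, K x y * f y * g x = H := by
      refine Finset.sum_congr rfl fun x _ => ?_
      rw [← Finset.sum_mul]
      change h x * (SignType.sign (h x) * |h x| ^ (s - 1)) = |h x| ^ s
      rw [← mul_assoc, self_mul_sign, ← Real.rpow_one_add' (abs_nonneg _) (by linarith)]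
      congr 1
      ring
    have hg : ∑ x, |g x| ^ r = H := by
      refine Finset.sum_congr rfl fun x _ => ?_
      change |SignType.sign (h x) * |h x| ^ (s - 1)| ^ r = |h x| ^ s
      rcases eq_or_ne (h x) 0 with h0 | h0
      · simp [h0, Real.zero_rpow hs0.ne', Real.zero_rpow hr0.ne']
      · have : |((SignType.sign (h x) : SignType) : ℝ)| = 1 := by
          rcases lt_or_gt_of_ne h0 with h' | h' <;> simp [h']
        rw [abs_mul, this, one_mul, abs_of_nonneg (by positivity), ← Real.rpow_mul (abs_nonneg _),
          hrs]
    have key := abs_sum_kernel_interpolate ha hb hKa hKb hr0 (θ := 2 / s) (by positivity)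
      ((div_le_one hs0).2 hs2.le) (by
        rw [show 1 - 2 / s / 2 = 1 / r by rw [h1r]; ring]
        field_simp) f g
    rw [hfg, hg, abs_of_nonneg hH0] at key
    rcases hH0.eq_or_lt with h0 | h0
    · rw [← h0, Real.zero_rpow (by positivity)]
      positivity
    · have hHr : 0 < H ^ (1 / r) := Real.rpow_pos_of_pos h0 _
      refine le_of_mul_le_mul_right ?_ hHr
      rw [← Real.rpow_add h0, hsr, Real.rpow_one, mul_assoc]
      exact key

/-- The eigenvalue of `Sop q G n` on the eigenvectors of `Tq q G` with eigenvalue `lam`. -/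
noncomputable def sphereEigenvalue (q : ℕ) (lam : ℝ) : ℕ → ℝ
  | 0 => 1
  | 1 => lam
  | 2 => lam * lam - (1 + 1 / (q : ℝ))
  | (n + 3) => lam * sphereEigenvalue q lam (n + 2) - sphereEigenvalue q lam (n + 1)

theorem abs_sphereEigenvalue_le {q : ℕ} (hq : 2 ≤ q) {lam : ℝ} (hlam : lam ∈ Set.Icc (-2 : ℝ) 2)
    {n : ℕ} (hn : 1 ≤ n) : |sphereEigenvalue q lam n| ≤ 6 * n := by
  obtain ⟨hl, hu⟩ := hlam
  have hq' : (2 : ℝ) ≤ q := by exact_mod_cast hq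
  have hinv : 1 / (q : ℝ) ≤ 1 / 2 := one_div_le_one_div_of_le (by norm_num) hq'
  have hinv0 : 0 < 1 / (q : ℝ) := by positivity
  suffices h : ∀ k : ℕ, |sphereEigenvalue q lam (k + 1)| ≤ 6 * (k + 1 : ℝ) ∧
      sphereEigenvalue q lam (k + 2) ^ 2
        - lam * sphereEigenvalue q lam (k + 1) * sphereEigenvalue q lam (k + 2)
        + sphereEigenvalue q lam (k + 1) ^ 2 ≤ 36 by
    obtain ⟨k, rfl⟩ := Nat.exists_eq_add_of_le' hn
    simpa using (h k).1
  intro k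
  induction k with
  | zero =>
    simp only [sphereEigenvalue]
    refine ⟨abs_le.2 ⟨by push_cast; linarith, by push_cast; linarith⟩, ?_⟩
    nlinarith [mul_nonneg hinv0.le (sq_nonneg lam)]
  | succ k ih =>
    obtain ⟨h1, h2⟩ := ih
    have hrec : sphereEigenvalue q lam (k + 1 + 2) =
      lam * sphereEigenvalue q lam (k + 1 + 1) - sphereEigenvalue q lam (k + 1) := rfl
    change _ ∧ sphereEigenvalue q lam (k + 1 + 2) ^ 2 - _ + _ ≤ 36
    change |sphereEigenvalue q lam (k + 2)| ≤ _ ∧ _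
    rw [hrec]
    change _ ∧ (lam * sphereEigenvalue q lam (k + 2) - sphereEigenvalue q lam (k + 1)) ^ 2
      - lam * sphereEigenvalue q lam (k + 2) *
        (lam * sphereEigenvalue q lam (k + 2) - sphereEigenvalue q lam (k + 1))
      + sphereEigenvalue q lam (k + 2) ^ 2 ≤ 36
    generalize sphereEigenvalue q lam (k + 2) = v at *
    generalize sphereEigenvalue q lam (k + 1) = u at *
    refine ⟨?_, by nlinarith⟩
    have hlam4 : lam ^ 2 ≤ 4 := by nlinarith
    have h3 : |v - lam / 2 * u| ≤ 6 := by
      refine abs_le_of_sq_le_sq ?_ (by norm_num)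
      nlinarith [mul_nonneg (sub_nonneg.2 hlam4) (sq_nonneg u)]
    have h4 : |lam / 2 * u| ≤ |u| := by
      rw [abs_mul]
      exact mul_le_of_le_one_left (abs_nonneg u) (abs_le.2 ⟨by linarith, by linarith⟩)
    have h5 := abs_add_le (v - lam / 2 * u) (lam / 2 * u)
    rw [sub_add_cancel] at h5
    push_cast
    linarith

/-- The value of `Sop q G n` on constants. -/
theorem sphereEigenvalue_trivial {q : ℕ} (hq : 0 < q) {n : ℕ} (hn : 1 ≤ n) :
    sphereEigenvalue q (((q : ℝ) + 1) / √q) n = (1 + 1 / (q : ℝ)) * √q ^ n := by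
  have hs : 0 < √(q : ℝ) := by positivity
  have hsq : √(q : ℝ) * √q = q := Real.mul_self_sqrt (by positivity)
  obtain ⟨k, rfl⟩ := Nat.exists_eq_add_of_le' hn
  generalize √(q : ℝ) = s at *
  rw [← hsq]
  induction k using Nat.strong_induction_on with
  | _ k ih =>
    match k with
    | 0 =>
      simp only [sphereEigenvalue]
      field_simp
      ring
    | 1 =>
      simp only [sphereEigenvalue]
      rw [← hsq]
      field_simp
      ring
    | (k + 2) =>
      change (s * s + 1) / s * sphereEigenvalue q _ (k + 1 + 1) - sphereEigenvalue q _ (k + 1) = _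
      rw [ih (k + 1) (by omega) (by omega), ih k (by omega) (by omega)]
      field_simp
      ring

section

variable {V : Type*} [Fintype V] {q : ℕ} {G : SimpleGraph V} [DecidableRel G.Adj]

theorem Tq_sum_mul {ι : Type*} [Fintype ι] (F : ι → V → ℝ) (c : ι → ℝ) (x : V) :
    Tq q G (fun z => ∑ i, F i z * c i) x = ∑ i, Tq q G (F i) x * c i := by
  simp only [Tq, mul_assoc, Finset.sum_mul, Finset.mul_sum]
  rw [Finset.sum_comm]

theorem sum_Tq_mul (f g : V → ℝ) : ∑ x, Tq q G f x * g x = ∑ x, f x * Tq q G g x := by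
  simp only [Tq, Finset.mul_sum, Finset.sum_mul, SimpleGraph.neighborFinset_eq_filter,
    Finset.sum_filter]
  rw [Finset.sum_comm]
  refine Finset.sum_congr rfl fun x _ => Finset.sum_congr rfl fun y _ => ?_
  simp only [G.adj_comm y x]
  split_ifs <;> ring

theorem Tq_const (hG : G.IsRegularOfDegree (q + 1)) :
    Tq q G (fun _ => 1) = fun _ => ((q : ℝ) + 1) / √q * 1 := by
  funext x
  simp [Tq, hG.degree_eq x, div_eq_inv_mul]

theorem Sop_eq_sum_Kker [DecidableEq V] : ∀ (n : ℕ) (f : V → ℝ) (x : V),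
    Sop q G n f x = ∑ y, Kker q G n x y * f y
  | 0, f, x => by simp [Kker, Sop]
  | 1, f, x => by
    simp only [Kker, Sop]
    rw [← Tq_sum_mul]
    simp
  | 2, f, x => by
    simp only [Kker, Sop, sub_mul, Finset.sum_sub_distrib]
    rw [← Tq_sum_mul]
    simp_rw [← Tq_sum_mul]
    simp
  | (n + 3), f, x => by
    have h1 := Sop_eq_sum_Kker (n + 1) f
    have h2 := Sop_eq_sum_Kker (n + 2) f
    simp only [Kker, Sop, sub_mul, Finset.sum_sub_distrib] at h1 h2 ⊢
    rw [← Tq_sum_mul, h1]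
    congr 2
    funext z
    exact h2 z

theorem sum_Sop_mul_eigenvector {e : V → ℝ} {lam : ℝ} (he : Tq q G e = fun x => lam * e x) :
    ∀ (n : ℕ) (f : V → ℝ),
      ∑ x, Sop q G n f x * e x = sphereEigenvalue q lam n * ∑ x, f x * e x := by
  have hT : ∀ f : V → ℝ, ∑ x, Tq q G f x * e x = lam * ∑ x, f x * e x := fun f => by
    rw [sum_Tq_mul, he, Finset.mul_sum]
    exact Finset.sum_congr rfl fun x _ => by ring
  intro n
  induction n using Nat.strong_induction_on with
  | _ n ih =>
    intro f
    match n with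
    | 0 => simp [Sop, sphereEigenvalue]
    | 1 => exact hT f
    | 2 =>
      simp only [Sop, sphereEigenvalue, sub_mul, Finset.sum_sub_distrib, hT, mul_assoc,
        ← Finset.mul_sum]
    | (n + 3) =>
      simp only [Sop, sphereEigenvalue, sub_mul, Finset.sum_sub_distrib, hT, mul_assoc]
      rw [ih (n + 2) (by omega), ih (n + 1) (by omega)]

theorem Sop_eigenvector {e : V → ℝ} {lam : ℝ} (he : Tq q G e = fun x => lam * e x) :
    ∀ n : ℕ, Sop q G n e = fun x => sphereEigenvalue q lam n * e x := by
  have hT : ∀ c : ℝ, Tq q G (fun x => c * e x) = fun x => lam * c * e x := fun c => by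
    funext x
    have := Tq_sum_mul (q := q) (G := G) (ι := Unit) (fun _ => e) (fun _ => c) x
    simp only [Finset.univ_unique, Finset.sum_singleton, he] at this
    simp only [mul_comm c]
    rw [this]
    ring
  intro n
  induction n using Nat.strong_induction_on with
  | _ n ih =>
    match n with
    | 0 => simp [Sop, sphereEigenvalue]
    | 1 => exact he
    | 2 =>
      simp only [Sop, sphereEigenvalue, he, hT]
      funext x
      ring
    | (n + 3) =>
      simp only [Sop, sphereEigenvalue]
      rw [ih (n + 2) (by omega), ih (n + 1) (by omega), hT]
      funext x
      ring

theorem sum_sq_Sop_le (hq : 2 ≤ q) (hR : IsRamanujan q G) {n : ℕ} (hn : 1 ≤ n) {f : V → ℝ}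
    (hf : ∑ x, f x = 0) :
    ∑ x, Sop q G n f x ^ 2 ≤ (6 * n : ℝ) ^ 2 * ∑ x, f x ^ 2 := by
  classical
  let T : EuclideanSpace ℝ V →ₗ[ℝ] EuclideanSpace ℝ V :=
    { toFun := fun u => WithLp.toLp 2 (Tq q G u)
      map_add' := fun u v => by
        ext x
        simp [Tq, Finset.sum_add_distrib, mul_add]
      map_smul' := fun c u => by
        ext x
        simp only [Tq, PiLp.smul_apply, smul_eq_mul, RingHom.id_apply, ← Finset.mul_sum]
        ring }
  have hinner : ∀ u v : EuclideanSpace ℝ V, inner ℝ u v = ∑ x, v x * u x := fun u v => by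
    simp [PiLp.inner_apply]
  have hT : T.IsSymmetric := fun u v => by
    rw [hinner, hinner]
    exact (sum_Tq_mul _ _).symm
  let e := hT.eigenvectorBasis rfl
  have hnorm : ∀ g : V → ℝ, ∑ x, g x ^ 2 = ∑ i, (∑ x, g x * e i x) ^ 2 := fun g => by
    have h1 := e.sum_sq_inner_right (WithLp.toLp 2 g)
    rw [EuclideanSpace.real_norm_sq_eq] at h1
    rw [← h1]
    exact Finset.sum_congr rfl fun i _ => by rw [hinner]
  rw [hnorm, hnorm f, Finset.mul_sum]
  refine Finset.sum_le_sum fun i _ => ?_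
  have hev := hT.hasEigenvector_eigenvectorBasis rfl i
  set lam : ℝ := hT.eigenvalues rfl i
  have he : Tq q G (e i) = fun x => lam * e i x := by
    have := hT.apply_eigenvectorBasis rfl i
    funext x
    exact congrArg (fun u : EuclideanSpace ℝ V => u x) this
  rw [sum_Sop_mul_eigenvector he, mul_pow]
  have hne : (e i : V → ℝ) ≠ 0 := fun h => hev.2 (by ext x; exact congrFun h x)
  rcases hR.1 (e i) lam hne he with h | h
  · gcongr ?_ * _
    exact sq_le_sq.2 ((abs_sphereEigenvalue_le hq h hn).trans (le_abs_self _))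
  · rw [h] at he
    obtain ⟨a, ha⟩ := hR.2 _ he
    have : ∑ x, f x * e i x = 0 := by
      rw [ha, ← Finset.sum_mul, hf, zero_mul]
    rw [this]
    simp

theorem sum_Pproj (f : V → ℝ) : ∑ x, Pproj f x = 0 := by
  rcases isEmpty_or_nonempty V with h | h
  · simp
  · simp only [Pproj, Finset.sum_sub_distrib, Finset.sum_const, Finset.card_univ, nsmul_eq_mul]
    field_simp
    simp

theorem sum_sq_Pproj_le (f : V → ℝ) : ∑ x, Pproj f x ^ 2 ≤ ∑ x, f x ^ 2 := by
  have h : ∀ x, f x ^ 2 = Pproj f x ^ 2 + 2 * ((∑ y, f y) / (Fintype.card V)) * Pproj f x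
      + ((∑ y, f y) / (Fintype.card V)) ^ 2 := fun x => by
    simp only [Pproj]
    ring
  simp only [h, Finset.sum_add_distrib, ← Finset.mul_sum, sum_Pproj]
  have : 0 ≤ ∑ _x : V, ((∑ y, f y) / (Fintype.card V)) ^ 2 := by positivity
  linarith

theorem Sop_Pproj_eq_sum [DecidableEq V] (hG : G.IsRegularOfDegree (q + 1))
    (n : ℕ) (f : V → ℝ) (x : V) :
    Sop q G n (Pproj f) x =
      ∑ y, (Kker q G n x y
        - sphereEigenvalue q (((q : ℝ) + 1) / √q) n / Fintype.card V) * f y := by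
  have h1 := congrFun (Sop_eigenvector (Tq_const hG) n) x
  rw [Sop_eq_sum_Kker] at h1 ⊢
  simp only [mul_one] at h1
  simp only [Pproj, mul_sub, sub_mul, Finset.sum_sub_distrib, ← Finset.sum_mul, ← Finset.mul_sum,
    h1]
  ring

theorem abs_sum_Sop_Pproj_mul_le (hq : 2 ≤ q) (hR : IsRamanujan q G) {n : ℕ} (hn : 1 ≤ n)
    (f g : V → ℝ) :
    |∑ x, Sop q G n (Pproj f) x * g x| ≤ 6 * n * (√(∑ x, f x ^ 2) * √(∑ x, g x ^ 2)) := by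
  have h := (sum_sq_Sop_le hq hR hn (sum_Pproj f)).trans
    (mul_le_mul_of_nonneg_left (sum_sq_Pproj_le f) (by positivity))
  refine abs_le_of_sq_le_sq ?_ (by positivity)
  rw [mul_pow, mul_pow _ (√_), Real.sq_sqrt (by positivity), Real.sq_sqrt (by positivity), ← mul_assoc]
  refine (Finset.sum_mul_sq_le_sq_mul_sq _ _ _).trans ?_
  gcongr

end

theorem abs_Kker_sub_le {V : Type*} [Fintype V] [DecidableEq V] {q : ℕ} (hq : 2 ≤ q)
    {G : SimpleGraph V} [DecidableRel G.Adj] {β C₀ : ℝ} (hC₀ : 0 < C₀) {N : ℕ}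
    (hN : (N : ℝ) ≤ Real.logb q (Fintype.card V)) (hK : CondStarStar q G β C₀ N)
    {n : ℕ} (hn : 1 ≤ n) (hnN : n ≤ N) (x y : V) :
    |Kker q G n x y - sphereEigenvalue q (((q : ℝ) + 1) / √q) n / Fintype.card V| ≤
      (C₀ + 2) * (q : ℝ) ^ (-(min β (1 / 2) * n)) := by
  have hq' : (2 : ℝ) ≤ q := by exact_mod_cast hq
  have hq0 : (0 : ℝ) < q := by linarith
  have hcard : 0 < (Fintype.card V : ℝ) := by
    have : Nonempty V := ⟨x⟩
    exact_mod_cast Fintype.card_pos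
  have hcn : (q : ℝ) ^ (n : ℝ) ≤ Fintype.card V := by
    rw [← Real.le_logb_iff_rpow_le (by linarith) hcard]
    exact le_trans (by exact_mod_cast hnN) hN
  have h1 : |Kker q G n x y| ≤ C₀ * (q : ℝ) ^ (-(min β (1 / 2) * n)) := by
    refine (hK n hn hnN x y).trans ?_
    gcongr
    · linarith
    · exact min_le_left _ _
  have h2 : |sphereEigenvalue q (((q : ℝ) + 1) / √q) n / Fintype.card V| ≤
      2 * (q : ℝ) ^ (-(min β (1 / 2) * n)) := by
    rw [sphereEigenvalue_trivial (by omega) hn, abs_of_nonneg (by positivity)]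
    have hs : √(q : ℝ) ^ n = (q : ℝ) ^ ((n : ℝ) / 2) := by
      rw [Real.sqrt_eq_rpow, ← Real.rpow_natCast, ← Real.rpow_mul hq0.le]
      congr 1
      ring
    have hinv : 1 / (q : ℝ) ≤ 1 := by
      rw [div_le_one hq0]
      linarith
    calc (1 + 1 / (q : ℝ)) * √q ^ n / Fintype.card V
        ≤ 2 * (q : ℝ) ^ ((n : ℝ) / 2) / (q : ℝ) ^ (n : ℝ) := by
          rw [hs]
          gcongr
          linarith
      _ = 2 * (q : ℝ) ^ (-(1 / 2 * (n : ℝ))) := by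
          rw [mul_div_assoc, ← Real.rpow_sub hq0]
          congr 2
          ring
      _ ≤ _ := by
          gcongr
          · linarith
          · exact min_le_right _ _
  refine (abs_sub _ _).trans ?_
  linarith

theorem statement4 (q : ℕ) (hq : 2 ≤ q) (β C₀ : ℝ) (hβ : 0 < β) (hC₀ : 0 < C₀)
    (p p' : ℝ≥0∞) (hp'1 : 1 ≤ p') (hp'2 : p' < 2) (hp2 : 2 < p)
    (hconj : 1 / p + 1 / p' = 1) :
    ∃ βp C : ℝ, 0 < βp ∧ 0 < C ∧
      ∀ (V : Type) [Fintype V] [DecidableEq V] (G : SimpleGraph V) [DecidableRel G.Adj],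
        G.IsRegularOfDegree (q + 1) → IsRamanujan q G →
        ∀ N : ℕ, 1 ≤ N → (N : ℝ) ≤ Real.logb q (Fintype.card V) →
          CondStarStar q G β C₀ N →
          ∀ n : ℕ, 1 ≤ n → n ≤ N → ∀ f : V → ℝ,
            gNorm p (Sop q G n (Pproj f)) ≤ C * (q : ℝ) ^ (-(βp * (n : ℝ))) * gNorm p' f := by
  have hq' : (2 : ℝ) ≤ q := by exact_mod_cast hq
  have hq0 : (0 : ℝ) < q := by linarith
  have hlog : 0 < Real.log q := Real.log_pos (by linarith)
  set θ := 2 / p.toReal with hθ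
  have hθ0 : 0 ≤ θ := by positivity
  have hθ1 : θ < 1 := by
    rcases eq_or_ne p ⊤ with rfl | hp
    · simp [hθ]
    · have := (ENNReal.toReal_lt_toReal (by norm_num) hp).2 hp2
      rw [toReal_ofNat] at this
      rw [hθ, div_lt_one (by linarith)]
      exact this
  set γ := min β (1 / 2) with hγ
  have hγ0 : 0 < γ := lt_min hβ (by norm_num)
  set ε := γ * (1 - θ) / 2 with hε
  have hε0 : 0 < ε := by
    have : 0 < 1 - θ := by linarith
    positivity
  refine ⟨ε, (C₀ + 2) ^ (1 - θ) * (24 / (ε * Real.log q)), hε0, by positivity, ?_⟩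
  intro V _ _ G _ hG hR N hN1 hN hK n hn hnN f
  have hn1 : (1 : ℝ) ≤ n := by exact_mod_cast hn
  have key := gNorm_kernel_le (a := (C₀ + 2) * (q : ℝ) ^ (-(γ * n))) (b := 6 * (n : ℝ))
    (by positivity) (by positivity)
    (abs_Kker_sub_le hq hC₀ hN hK hn hnN) (fun f g => by
      simp_rw [← Finset.sum_mul, ← Sop_Pproj_eq_sum hG]
      exact abs_sum_Sop_Pproj_mul_le hq hR hn f g) hp2 hconj f
  rw [← funext (Sop_Pproj_eq_sum hG n f)] at key
  refine key.trans ?_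
  have hgn : 0 ≤ gNorm p' f := by
    unfold gNorm
    split_ifs
    · exact Real.iSup_nonneg fun _ => abs_nonneg _
    · positivity
  refine mul_le_mul_of_nonneg_right ?_ hgn
  have h24 : (4 * (6 * (n : ℝ))) ^ θ ≤ 24 / (ε * Real.log q) * (q : ℝ) ^ (ε * n) := by
    calc (4 * (6 * (n : ℝ))) ^ θ ≤ (4 * (6 * (n : ℝ))) ^ (1 : ℝ) :=
          Real.rpow_le_rpow_of_exponent_le (by linarith) hθ1.le
      _ = 24 / (ε * Real.log q) * (Real.log q * (ε * n)) := by
          rw [Real.rpow_one]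
          field_simp
          ring
      _ ≤ _ := by
          rw [Real.rpow_def_of_pos hq0]
          gcongr
          linarith [Real.add_one_le_exp (Real.log q * (ε * n))]
  rw [Real.mul_rpow (by positivity) (by positivity), ← Real.rpow_mul hq0.le]
  calc (C₀ + 2) ^ (1 - θ) * (q : ℝ) ^ (-(γ * n) * (1 - θ)) * (4 * (6 * (n : ℝ))) ^ θ
      ≤ (C₀ + 2) ^ (1 - θ) * (q : ℝ) ^ (-(γ * n) * (1 - θ)) *
        (24 / (ε * Real.log q) * (q : ℝ) ^ (ε * n)) := by gcongr
    _ = (C₀ + 2) ^ (1 - θ) * (24 / (ε * Real.log q)) *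
        ((q : ℝ) ^ (-(γ * n) * (1 - θ)) * (q : ℝ) ^ (ε * n)) := by ring
    _ = _ := by
      rw [← Real.rpow_add hq0]
      congr 2
      rw [hε]
      ring
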